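/- arXiv:2312.13207 — 13 statements merged into one kernel-verified Lean document; each statement's English description precedes it below -/
import Mathlib

section
/- Let V ⊆ V(G) be nonempty and let d be a divisor on G that is effective away from V. Then d is V-reduced if and only if the Dhar set W_Dhar(d, V) is empty. -/
open Finset

variable {V : Type*}

/-- The simple graph underlying the multigraph given by the symmetric
edge-multiplicity function `m` (loops are irrelevant for this graph). -/
def graphOf (m : V → V → ℕ) : SimpleGraph V :=
  SimpleGraph.fromRel fun a b => 0 < m a b

/-- The principal divisor of an integer-valued function `f`:
its value at `v` is the sum over all edges `e = vw` of `f w - f v` (loops contribute 0). -/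
def divOf [Fintype V] (m : V → V → ℕ) (f : V → ℤ) : V → ℤ :=
  fun v => ∑ w, (m v w : ℤ) * (f w - f v)

/-- The principal divisor of a real-valued function. -/
def rDivOf [Fintype V] (m : V → V → ℕ) (f : V → ℝ) : V → ℝ :=
  fun v => ∑ w, (m v w : ℝ) * (f w - f v)

/-- The (integer-valued) indicator function of a set of vertices. -/
noncomputable def ind (W : Set V) : V → ℤ := W.indicator 1

/-- Two divisors are linearly equivalent if they differ by a principal divisor. -/
def LinEquiv [Fintype V] (m : V → V → ℕ) (d e : V → ℤ) : Prop :=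
  ∃ f : V → ℤ, ∀ v, d v - e v = divOf m f v

/-- A divisor is `S`-reduced if it is effective away from `S` and chip-firing along any
nonempty `W` disjoint from `S` turns it negative at some vertex of `W`. -/
def VReduced [Fintype V] (m : V → V → ℕ) (S : Set V) (d : V → ℤ) : Prop :=
  (∀ v ∉ S, 0 ≤ d v) ∧
    ∀ W : Set V, W.Nonempty → W ⊆ Sᶜ →
      ∃ w ∈ W, d w + divOf m (ind W) w < 0

/-- One step of the Dhar iteration: add to `A` those vertices outside `A` at which
chip-firing along the complement of `A` makes `d` negative. -/
def dharStep [Fintype V] (m : V → V → ℕ) (d : V → ℤ) (A : Set V) : Set V :=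
  A ∪ {v | v ∉ A ∧ d v + divOf m (ind Aᶜ) v < 0}

/-- The Dhar iteration starting at `S`. -/
def dharIter [Fintype V] (m : V → V → ℕ) (d : V → ℤ) (S : Set V) : ℕ → Set V
  | 0 => S
  | n + 1 => dharStep m d (dharIter m d S n)

/-- The Dhar set `W_Dhar(d, S)`: the complement of the stabilized Dhar iteration
(the increasing iteration is certainly stable after `Fintype.card V` steps). -/
def dharSet [Fintype V] (m : V → V → ℕ) (d : V → ℤ) (S : Set V) : Set V :=
  (dharIter m d S (Fintype.card V))ᶜ

/-- `q` is the function `q_E(D)`: `E = D + div q` and the minimum value of `q` is `0`.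
On a connected graph such a function exists and is unique. -/
def IsQRep [Fintype V] (m : V → V → ℕ) (E D : V → ℝ) (q : V → ℝ) : Prop :=
  (∀ v, E v = D v + rDivOf m q v) ∧ (∀ v, 0 ≤ q v) ∧ (∃ v, q v = 0)

/-- The valence of a vertex: the number of edge-endpoints at `v`, loops counted twice. -/
def valence [Fintype V] (m : V → V → ℕ) (v : V) : ℕ := (∑ w, m v w) + m v v

/-- The number of non-loop edges adjacent to a vertex. -/
def valwl [Fintype V] [DecidableEq V] (m : V → V → ℕ) (v : V) : ℕ :=
  ∑ w ∈ Finset.univ.erase v, m v w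

/-- The canonical divisor of a vertex-weighted graph. -/
def canon [Fintype V] (m : V → V → ℕ) (g : V → ℕ) (v : V) : ℤ :=
  2 * (g v : ℤ) - 2 + (valence m v : ℤ)

/-- A divisor class (given by a representative `d₀`) is special if it is effective
and its residual class is effective. -/
def Special [Fintype V] (m : V → V → ℕ) (g : V → ℕ) (d₀ : V → ℤ) : Prop :=
  (∃ e : V → ℤ, LinEquiv m d₀ e ∧ ∀ v, 0 ≤ e v) ∧
    (∃ e : V → ℤ, LinEquiv m (fun v => canon m g v - d₀ v) e ∧ ∀ v, 0 ≤ e v)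

/-- A divisor is uniform if it and its residual are effective. -/
def Uniform [Fintype V] (m : V → V → ℕ) (g : V → ℕ) (d : V → ℤ) : Prop :=
  ∀ v, 0 ≤ d v ∧ d v ≤ canon m g v

/-- The distance from a vertex to a set of vertices in the underlying graph. -/
noncomputable def distToSet [Fintype V] (m : V → V → ℕ) (S : Set V) (v : V) : ℕ :=
  sInf ((fun s => (graphOf m).dist v s) '' S)

theorem divOf_ind_mono [Fintype V] (m : V → V → ℕ) {A B : Set V} (hAB : A ⊆ B) {v : V}
    (hv : v ∈ A) : divOf m (ind A) v ≤ divOf m (ind B) v := by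
  unfold divOf ind
  apply Finset.sum_le_sum
  intro w _
  apply mul_le_mul_of_nonneg_left _ (Int.natCast_nonneg _)
  have h1 : A.indicator (1 : V → ℤ) w ≤ B.indicator 1 w :=
    Set.indicator_le_indicator_of_subset hAB (fun _ => zero_le_one) w
  rw [Set.indicator_of_mem hv, Set.indicator_of_mem (hAB hv)]
  linarith

theorem subset_dharIter [Fintype V] (m : V → V → ℕ) (d : V → ℤ) (S : Set V) (n : ℕ) :
    S ⊆ dharIter m d S n := by
  induction n with
  | zero => exact subset_rfl
  | succ n ih => exact ih.trans Set.subset_union_left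

theorem dharIter_card [Fintype V] (m : V → V → ℕ) (d : V → ℤ) (S : Set V)
    (h : VReduced m S d) (n : ℕ) :
    dharIter m d S n = Set.univ ∨ n ≤ (dharIter m d S n).ncard := by
  induction n with
  | zero => right; exact Nat.zero_le _
  | succ n ih =>
    by_cases hu : dharIter m d S n = Set.univ
    · left
      apply Set.univ_subset_iff.1
      rw [← hu]
      exact Set.subset_union_left
    · right
      have hn := ih.resolve_left hu
      obtain ⟨w, hw, hneg⟩ := h.2 (dharIter m d S n)ᶜ (Set.nonempty_compl.2 hu)
        (Set.compl_subset_compl.2 (subset_dharIter m d S n))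
      have hlt : dharIter m d S n ⊂ dharIter m d S (n + 1) := by
        refine ⟨Set.subset_union_left, fun hsub => hw (hsub ?_)⟩
        exact Or.inr ⟨hw, hneg⟩
      have := Set.ncard_lt_ncard hlt (Set.toFinite _)
      omega

/-- Lemma `lma: decomp reduced`: for nonempty `S` and a divisor `d`
effective away from `S`, `d` is `S`-reduced iff the Dhar set `W_Dhar(d, S)` is empty. -/
theorem stmt0 [Fintype V] (m : V → V → ℕ) (hsym : ∀ a b, m a b = m b a)
    (hconn : (graphOf m).Connected) (S : Set V) (hS : S.Nonempty)
    (d : V → ℤ) (heff : ∀ v ∉ S, 0 ≤ d v) :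
    VReduced m S d ↔ dharSet m d S = ∅ := by
  constructor
  · intro h
    unfold dharSet
    rw [Set.compl_empty_iff]
    rcases dharIter_card m d S h (Fintype.card V) with h1 | h1
    · exact h1
    · apply Set.eq_of_subset_of_ncard_le (Set.subset_univ _) _ (Set.toFinite _)
      rw [Set.ncard_univ, Nat.card_eq_fintype_card]
      exact h1
  · intro h
    refine ⟨heff, fun W hW hWS => ?_⟩
    by_contra hcon
    push Not at hcon
    have key : ∀ n, W ⊆ (dharIter m d S n)ᶜ := by
      intro n
      induction n with
      | zero => exact hWS
      | succ n ih =>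
        rintro v hv (h1 | ⟨_, h2⟩)
        · exact ih hv h1
        · have := divOf_ind_mono m ih hv
          have := hcon v hv
          linarith
    obtain ⟨w, hw⟩ := hW
    have : w ∈ dharSet m d S := key _ hw
    rw [h] at this
    exact this
end

section
/- For every divisor d on G and every nonempty subset V ⊆ V(G), there exists a divisor d' linearly equivalent to d that is V-reduced. -/
open Finset

variable {V : Type*}

theorem divOf_add [Fintype V] (m : V → V → ℕ) (f g : V → ℤ) (v : V) :
    divOf m (fun x => f x + g x) v = divOf m f v + divOf m g v := by
  unfold divOf
  rw [← Finset.sum_add_distrib]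
  exact Finset.sum_congr rfl fun w _ => by ring

theorem divOf_affine [Fintype V] (m : V → V → ℕ) (N c : ℤ) (g : V → ℤ) (v : V) :
    divOf m (fun x => N * (g x - c)) v = N * divOf m g v := by
  unfold divOf
  rw [Finset.mul_sum]
  exact Finset.sum_congr rfl fun w _ => by ring

theorem exists_sub [Fintype V] (m : V → V → ℕ) (hsym : ∀ a b, m a b = m b a)
    (hconn : (graphOf m).Connected) (s : V) :
    ∃ h : V → ℤ, (∀ v, 0 ≤ h v) ∧ ∀ v, v ≠ s → 1 ≤ divOf m h v := by
  obtain ⟨n, hn⟩ : ∃ n, ∀ v, (graphOf m).dist v s ≤ n :=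
    ⟨∑ v, (graphOf m).dist v s, fun v =>
      Finset.single_le_sum (f := fun v => (graphOf m).dist v s)
        (fun _ _ => Nat.zero_le _) (Finset.mem_univ v)⟩
  obtain ⟨M, hM⟩ : ∃ M : ℕ, ∀ v, ∑ w, m v w ≤ M :=
    ⟨∑ v, ∑ w, m v w, fun v =>
      Finset.single_le_sum (f := fun v => ∑ w, m v w)
        (fun _ _ => Nat.zero_le _) (Finset.mem_univ v)⟩
  let h : V → ℤ := fun v => ((M : ℤ) + 1) ^ (n - (graphOf m).dist v s)
  have hpos : ∀ v, 1 ≤ h v := fun v => one_le_pow₀ (by omega)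
  refine ⟨h, fun v => by linarith [hpos v], fun v hv => ?_⟩
  obtain ⟨p, hp⟩ := (hconn v s).exists_walk_length_eq_dist
  cases p with
  | nil => exact absurd rfl hv
  | @cons _ u _ hadj p =>
    have hd : (graphOf m).dist u s + 1 ≤ (graphOf m).dist v s := by
      rw [← hp, SimpleGraph.Walk.length_cons]
      exact Nat.succ_le_succ (SimpleGraph.dist_le p)
    have hm : 0 < m v u := by
      have := (SimpleGraph.fromRel_adj _ _ _).1 hadj
      rcases this.2 with h1 | h1
      · exact h1
      · rw [hsym]; exact h1
    have hu : ((M : ℤ) + 1) * h v ≤ h u := by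
      change ((M : ℤ) + 1) * ((M : ℤ) + 1) ^ _ ≤ ((M : ℤ) + 1) ^ _
      rw [← pow_succ']
      have := hn v
      exact pow_le_pow_right₀ (by omega) (by omega)
    have e : divOf m h v = ∑ w, (m v w : ℤ) * h w - (∑ w, (m v w : ℤ)) * h v := by
      unfold divOf
      rw [Finset.sum_mul, ← Finset.sum_sub_distrib]
      exact Finset.sum_congr rfl fun w _ => by ring
    have h1 : (m v u : ℤ) * h u ≤ ∑ w, (m v w : ℤ) * h w :=
      Finset.single_le_sum (f := fun w => (m v w : ℤ) * h w)
        (fun w _ => mul_nonneg (by positivity) (by linarith [hpos w])) (Finset.mem_univ u)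
    have h2 : (∑ w, (m v w : ℤ)) ≤ M := by exact_mod_cast hM v
    have h3 : (1 : ℤ) ≤ m v u := by exact_mod_cast hm
    have h4 := hpos v
    have h5 := hpos u
    rw [e]
    nlinarith [mul_le_mul_of_nonneg_right h2 (by linarith : 0 ≤ h v),
      mul_le_mul_of_nonneg_right h3 (by linarith : 0 ≤ h u)]

/-- Lemma `lma: existence`: every divisor is linearly equivalent to an
`S`-reduced divisor, for any nonempty `S ⊆ V(G)`. -/
theorem stmt2 [Fintype V] (m : V → V → ℕ) (hsym : ∀ a b, m a b = m b a)
    (hconn : (graphOf m).Connected) (S : Set V) (hS : S.Nonempty) (d : V → ℤ) :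
    ∃ d' : V → ℤ, LinEquiv m d d' ∧ VReduced m S d' := by
  classical
  obtain ⟨s, hs⟩ := hS
  obtain ⟨h, h0, h1⟩ := exists_sub m hsym hconn s
  have hS1 : ∀ v, v ∉ S → 1 ≤ divOf m h v := fun v hv =>
    h1 v (fun e => hv (e ▸ hs))
  obtain ⟨H, hH⟩ : ∃ H, ∀ v, h v ≤ H :=
    ⟨∑ v, h v, fun v => Finset.single_le_sum (fun w _ => h0 w) (Finset.mem_univ v)⟩
  obtain ⟨N, hN0, hN⟩ : ∃ N : ℤ, 0 ≤ N ∧ ∀ v, |d v| < N := by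
    refine ⟨∑ v, |d v| + 1, ?_, fun v => ?_⟩
    · have := Finset.sum_nonneg (s := Finset.univ) (fun w _ => abs_nonneg (d w)); linarith
    · have := Finset.single_le_sum (f := fun v => |d v|) (fun w _ => abs_nonneg (d w))
        (Finset.mem_univ v)
      linarith
  let P : (V → ℤ) → Prop := fun f =>
    (∀ v ∈ S, f v ≤ 0) ∧ ∀ v, v ∉ S → 0 ≤ d v + divOf m f v
  have hPne : P (fun x => N * (h x - H)) := by
    refine ⟨fun v _ => ?_, fun v hv => ?_⟩
    · have := hH v
      exact mul_nonpos_of_nonneg_of_nonpos hN0 (by linarith)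
    · rw [divOf_affine]
      have := (abs_lt.1 (hN v)).1
      nlinarith [hS1 v hv]
  have hbd : ∀ f, P f → ∀ v, f v ≤ N * H := by
    intro f hf v
    obtain ⟨v0, -, hv0⟩ := Finset.exists_max_image Finset.univ
      (fun x => f x + N * (h x - 0)) ⟨s, Finset.mem_univ s⟩
    have hle : divOf m (fun x => f x + N * (h x - 0)) v0 ≤ 0 :=
      Finset.sum_nonpos fun w _ => mul_nonpos_of_nonneg_of_nonpos (by positivity)
        (by have := hv0 w (Finset.mem_univ w); linarith)
    have hv0S : v0 ∈ S := by
      by_contra hc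
      rw [divOf_add, divOf_affine] at hle
      have := (abs_lt.1 (hN v0)).2
      nlinarith [hS1 v0 hc, hf.2 v0 hc]
    have a1 := hv0 v (Finset.mem_univ v)
    have a2 := hf.1 v0 hv0S
    have a3 := mul_le_mul_of_nonneg_left (hH v0) hN0
    have a4 := mul_nonneg hN0 (h0 v)
    simp only [sub_zero] at a1
    linarith
  obtain ⟨z, ⟨f, hf, hfz⟩, hmax⟩ := Int.exists_greatest_of_bdd
    (P := fun z => ∃ f, P f ∧ ∑ v, f v = z)
    ⟨∑ _v : V, N * H, by
      rintro z ⟨f, hf, rfl⟩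
      exact Finset.sum_le_sum fun v _ => hbd f hf v⟩
    ⟨_, _, hPne, rfl⟩
  refine ⟨fun v => d v + divOf m f v, ⟨fun x => (-1) * (f x - 0), fun v => ?_⟩, hf.2, ?_⟩
  · rw [divOf_affine]; ring
  · intro W hW hWS
    by_contra! hc
    have hP : P (fun x => f x + ind W x) := by
      refine ⟨fun v hv => ?_, fun v hv => ?_⟩
      · have : v ∉ W := fun hw => hWS hw hv
        simpa [ind, this] using hf.1 v hv
      · rw [divOf_add]
        by_cases hw : v ∈ W
        · have := hc v hw; linarith
        · have : 0 ≤ divOf m (ind W) v := by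
            refine Finset.sum_nonneg fun w _ => mul_nonneg (by positivity) ?_
            by_cases hw' : w ∈ W <;> simp [ind, hw, hw']
          have := hf.2 v hv
          linarith
    have hle := hmax _ ⟨_, hP, rfl⟩
    rw [Finset.sum_add_distrib, hfz] at hle
    obtain ⟨w, hw⟩ := hW
    have := Finset.single_le_sum (f := ind W) (s := Finset.univ)
      (fun x _ => by by_cases hx : x ∈ W <;> simp [ind, hx]) (Finset.mem_univ w)
    have hw1 : ind W w = 1 := by simp [ind, hw]
    linarith
end

section
/- Let d be a divisor on G that is not effective but is linearly equivalent to an effective divisor, and let V ⊆ V(G) be the set of vertices at which d is negative. Then the Dhar set W_Dhar(d, V) is nonempty. -/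
open Finset

variable {V : Type*}

/-- Proposition `prop:Dhar decomp effective`: if `d` is not effective but
linearly equivalent to an effective divisor, and `S` is the set of vertices where `d` is
negative, then `W_Dhar(d, S)` is nonempty. -/
theorem stmt3 [Fintype V] (m : V → V → ℕ) (hsym : ∀ a b, m a b = m b a)
    (hconn : (graphOf m).Connected) (d : V → ℤ)
    (hnoteff : ∃ v, d v < 0)
    (heq : ∃ e : V → ℤ, LinEquiv m d e ∧ ∀ v, 0 ≤ e v) :
    (dharSet m d {v | d v < 0}).Nonempty := by
  obtain ⟨e, ⟨f, hf⟩, he⟩ := heq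
  obtain ⟨v0, -⟩ := hnoteff
  obtain ⟨u, -, hu⟩ := Finset.exists_min_image Finset.univ f ⟨v0, Finset.mem_univ v0⟩
  have key : ∀ n v, f v = f u → v ∉ dharIter m d {v | d v < 0} n := by
    intro n
    induction n with
    | zero =>
      intro v hv h
      have h1 : d v < 0 := h
      have h2 : 0 ≤ divOf m f v := by
        unfold divOf
        refine Finset.sum_nonneg fun w hw => mul_nonneg (by positivity) ?_
        have := hu w hw
        omega
      have := hf v
      have := he v
      omega
    | succ n ih =>
      intro v hv h
      rcases h with h | ⟨_, h⟩
      · exact ih v hv h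
      · have hvA := ih v hv
        set A := dharIter m d {v | d v < 0} n with hA
        have h2 : 0 ≤ divOf m f v + divOf m (ind Aᶜ) v := by
          unfold divOf
          rw [← Finset.sum_add_distrib]
          refine Finset.sum_nonneg fun w hw => ?_
          rw [← mul_add]
          refine mul_nonneg (by positivity) ?_
          have h3 := hu w hw
          have h4 : ind Aᶜ v = 1 := by simp [ind, hvA]
          by_cases hwA : w ∈ A
          · have h5 : ind Aᶜ w = 0 := by simp [ind, hwA]
            have h6 : f w ≠ f u := fun h => ih w h hwA
            omega
          · have h5 : ind Aᶜ w = 1 := by simp [ind, hwA]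
            omega
        have := hf v
        have := he v
        omega
  exact ⟨u, key _ u rfl⟩
end

section
/- Let d be a divisor on G that is not effective, and let V ⊆ V(G) be the set of vertices at which d is negative. If d is V-reduced, then no divisor linearly equivalent to d is effective. -/
open Finset

variable {V : Type*}

/-- Corollary to Proposition `prop:Dhar decomp effective`: if `d` is not
effective and is `S`-reduced, where `S` is the set of vertices where `d` is negative,
then no divisor linearly equivalent to `d` is effective. -/
theorem stmt4 [Fintype V] (m : V → V → ℕ) (hsym : ∀ a b, m a b = m b a)
    (hconn : (graphOf m).Connected) (d : V → ℤ)
    (hnoteff : ∃ v, d v < 0)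
    (hred : VReduced m {v | d v < 0} d) :
    ¬ ∃ e : V → ℤ, LinEquiv m d e ∧ ∀ v, 0 ≤ e v := by
  classical
  rintro ⟨e, ⟨f, hf⟩, he⟩
  obtain ⟨v0, hv0⟩ := hnoteff
  obtain ⟨w0, -, hw0⟩ := Finset.exists_min_image Finset.univ f ⟨v0, Finset.mem_univ _⟩
  have hmin : ∀ u, f w0 ≤ f u := fun u => hw0 u (Finset.mem_univ u)
  have key : ∀ w, f w = f w0 → - divOf m f w ≤ divOf m (ind {u | f u = f w0}) w := by
    intro w hw
    unfold divOf
    rw [← Finset.sum_neg_distrib]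
    refine Finset.sum_le_sum fun u _ => ?_
    rw [← mul_neg]
    refine mul_le_mul_of_nonneg_left ?_ (Int.natCast_nonneg _)
    have := hmin u
    by_cases hu : f u = f w0 <;> simp [ind, Set.indicator, hu, hw]
    omega
  have nonneg : ∀ w, f w = f w0 → 0 ≤ divOf m f w := by
    intro w hw
    refine Finset.sum_nonneg fun u _ => mul_nonneg (Int.natCast_nonneg _) ?_
    have := hmin u
    omega
  obtain ⟨w, hw, hlt⟩ := hred.2 {u | f u = f w0} ⟨w0, rfl⟩ (by
    intro w hw hneg
    have h1 := nonneg w hw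
    have h2 := hf w
    have h3 := he w
    have h4 : d w < 0 := hneg
    omega)
  have h1 := key w hw
  have h2 := hf w
  have h3 := he w
  omega
end

section
/- Let V ⊆ V(G) be nonempty and let d be a divisor effective away from V with W_Dhar(d, V) nonempty, and let d₁ = d + div(1_{W_Dhar(d,V)}) be the divisor obtained from d by the chip-firing move along W_Dhar(d, V). For each vertex v let dist(v) be the length of a shortest path in G from v to a vertex of V, let l = max_v dist(v), let S_k = {v ∈ V(G) : dist(v) = k} for k = 0, …, l, and set μ(e) = (∑_{v∈S_0} e_v, …, ∑_{v∈S_l} e_v) for a divisor e. Then μ(d₁) > μ(d) in the lexicographic order. -/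
open Finset

variable {V : Type*}

theorem distToSet_attained [Fintype V] (m : V → V → ℕ) (S : Set V) (hS : S.Nonempty) (v : V) :
    ∃ s ∈ S, (graphOf m).dist v s = distToSet m S v := by
  have := Nat.sInf_mem (hS.image (fun s => (graphOf m).dist v s))
  obtain ⟨s, hs, h⟩ := this
  exact ⟨s, hs, h⟩

theorem distToSet_le' [Fintype V] (m : V → V → ℕ) (S : Set V) (v s : V) (hs : s ∈ S) :
    distToSet m S v ≤ (graphOf m).dist v s :=
  Nat.sInf_le ⟨s, hs, rfl⟩

theorem distToSet_adj [Fintype V] (m : V → V → ℕ) (hconn : (graphOf m).Connected)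
    (S : Set V) (hS : S.Nonempty) (a b : V) (h : (graphOf m).Adj a b) :
    distToSet m S a ≤ distToSet m S b + 1 := by
  obtain ⟨s, hs, hd⟩ := distToSet_attained m S hS b
  have h1 := distToSet_le' m S a s hs
  have h2 := hconn.dist_triangle (u := a) (v := b) (w := s)
  have h3 : (graphOf m).dist a b = 1 := SimpleGraph.dist_eq_one_iff_adj.2 h
  omega

theorem divOf_ind_of_notMem [Fintype V] (m : V → V → ℕ) (W : Set V) (v : V) (hv : v ∉ W) :
    divOf m (ind W) v = ∑ w, (m v w : ℤ) * ind W w := by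
  simp [divOf, ind, hv]

theorem ind_nonneg' (W : Set V) (v : V) : 0 ≤ ind W v := by
  by_cases h : v ∈ W <;> simp [ind, h]

/-- termination argument for Algorithm 3.9: chip-firing along the
nonempty Dhar set strictly increases the tuple `μ` in the lexicographic order. -/
theorem stmt5 [Fintype V] (m : V → V → ℕ) (hsym : ∀ a b, m a b = m b a)
    (hconn : (graphOf m).Connected) (S : Set V) (hS : S.Nonempty)
    (d : V → ℤ) (heff : ∀ v ∉ S, 0 ≤ d v) (hW : (dharSet m d S).Nonempty)
    (d₁ : V → ℤ) (hd₁ : ∀ v, d₁ v = d v + divOf m (ind (dharSet m d S)) v) :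
    ∃ k ≤ Finset.univ.sup (fun v => distToSet m S v),
      (∀ j < k,
        ∑ v ∈ Finset.univ.filter (fun v => distToSet m S v = j), d₁ v =
          ∑ v ∈ Finset.univ.filter (fun v => distToSet m S v = j), d v) ∧
      ∑ v ∈ Finset.univ.filter (fun v => distToSet m S v = k), d v <
        ∑ v ∈ Finset.univ.filter (fun v => distToSet m S v = k), d₁ v := by
  obtain ⟨w, hwW, hmin⟩ := Set.exists_min_image (dharSet m d S) (distToSet m S)
    (Set.toFinite _) hW
  obtain ⟨s, hs, hds⟩ := distToSet_attained m S hS w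
  have hws : w ≠ s := by
    rintro rfl
    exact hwW (subset_dharIter m d S _ hs)
  obtain ⟨p, hp⟩ := hconn.exists_walk_length_eq_dist w s
  cases p with
  | nil => exact absurd rfl hws
  | @cons _ v _ hadj p =>
    have hvs : (graphOf m).dist v s ≤ p.length := SimpleGraph.dist_le p
    have h1 := distToSet_le' m S v s hs
    have h2 := distToSet_adj m hconn S hS w v hadj
    rw [SimpleGraph.Walk.length_cons] at hp
    have hk : distToSet m S v + 1 = distToSet m S w := by omega
    have hnot : ∀ u, distToSet m S u < distToSet m S w → u ∉ dharSet m d S :=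
      fun u hu hm => absurd (hmin u hm) (not_le.2 hu)
    have hmvw : 0 < m v w := by
      have := hadj
      simp only [graphOf, SimpleGraph.fromRel_adj] at this
      rcases this.2 with h | h
      · rwa [hsym]
      · exact h
    have hge : ∀ u, distToSet m S u < distToSet m S w →
        0 ≤ divOf m (ind (dharSet m d S)) u := by
      intro u hu
      rw [divOf_ind_of_notMem _ _ _ (hnot u hu)]
      exact Finset.sum_nonneg fun x _ => mul_nonneg (by positivity) (ind_nonneg' _ _)
    refine ⟨distToSet m S v, Finset.le_sup (f := fun v => distToSet m S v) (Finset.mem_univ v),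
      ?_, ?_⟩
    · intro j hj
      refine Finset.sum_congr rfl fun u hu => ?_
      have hu := (Finset.mem_filter.1 hu).2
      rw [hd₁, divOf_ind_of_notMem _ _ _ (hnot u (by omega)), Finset.sum_eq_zero, add_zero]
      intro x _
      by_cases hx : x ∈ dharSet m d S
      · have hxm := hmin x hx
        have : m u x = 0 := by
          by_contra h0
          have hne : x ≠ u := by
            rintro rfl
            omega
          have hxu : (graphOf m).Adj x u := by
            simp only [graphOf, SimpleGraph.fromRel_adj]
            exact ⟨hne, Or.inr (Nat.pos_of_ne_zero h0)⟩
          have := distToSet_adj m hconn S hS x u hxu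
          omega
        simp [this]
      · simp [ind, hx]
    · refine Finset.sum_lt_sum (fun u hu => ?_) ⟨v, by simp, ?_⟩
      · have hu := (Finset.mem_filter.1 hu).2
        rw [hd₁]
        have := hge u (by omega)
        omega
      · rw [hd₁, divOf_ind_of_notMem _ _ _ (hnot v (by omega))]
        have : 0 < ∑ x, (m v x : ℤ) * ind (dharSet m d S) x := by
          refine Finset.sum_pos' (fun x _ => mul_nonneg (by positivity) (ind_nonneg' _ _))
            ⟨w, Finset.mem_univ w, ?_⟩
          have : ind (dharSet m d S) w = 1 := by simp [ind, hwW]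
          rw [this]
          simpa using hmvw
        omega
end

section
/- Let E be an ℝ-divisor of degree d on G and let d, d' be two linearly equivalent divisors of degree d such that d' = d + div(1_{V'}) for a subset V' ⊆ V(G). If U_0(q_E(d')) is not contained in V', then ∑_{v∈V(G)} q_E(d)(v) = |V'| + ∑_{v∈V(G)} q_E(d')(v). -/
open Finset

variable {V : Type*}

theorem harm_const [Fintype V] (m : V → V → ℕ) (hsym : ∀ a b, m a b = m b a)
    (hconn : (graphOf m).Connected) (g : V → ℝ) (hg : ∀ v, rDivOf m g v = 0) :
    ∃ c, ∀ v, g v = c := by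
  haveI := hconn.nonempty
  obtain ⟨x, hx⟩ := Finite.exists_max g
  refine ⟨g x, fun v => ?_⟩
  have step : ∀ a b, (graphOf m).Adj a b → g a = g x → g b = g x := by
    intro a b hab ha
    have hm : 0 < m a b := by
      have h := hab
      unfold graphOf at h
      rw [SimpleGraph.fromRel_adj] at h
      rcases h.2 with h | h
      · exact h
      · rw [hsym]; exact h
    have h0 := hg a
    unfold rDivOf at h0
    have h1 := (Finset.sum_eq_zero_iff_of_nonpos (fun w _ =>
      mul_nonpos_of_nonneg_of_nonpos (Nat.cast_nonneg (m a w))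
        (by rw [ha]; linarith [hx w]))).1 h0 b (Finset.mem_univ b)
    have hm' : (m a b : ℝ) ≠ 0 := by exact_mod_cast hm.ne'
    have h2 := (mul_eq_zero.1 h1).resolve_left hm'
    linarith
  have walk : ∀ a b, (graphOf m).Walk a b → g a = g x → g b = g x := by
    intro a b p
    induction p with
    | nil => exact id
    | cons h _ ih => exact fun ha => ih (step _ _ h ha)
  obtain ⟨p⟩ := hconn.preconnected x v
  exact walk _ _ p rfl

/-- Corollary `cor:chip firing dynamics`: if `d'` is obtained from `d` by
chip-firing along `V'` and `U₀(q_E(d')) ⊄ V'`, then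
`∑ q_E(d) = |V'| + ∑ q_E(d')`. -/
theorem stmt7 [Fintype V] [DecidableEq V] (m : V → V → ℕ) (hsym : ∀ a b, m a b = m b a)
    (hconn : (graphOf m).Connected) (E : V → ℝ) (d d' : V → ℤ) (V' : Finset V)
    (hdeg : ∑ v, E v = ∑ v, (d v : ℝ))
    (hd' : ∀ v, d' v = d v + divOf m (fun w => if w ∈ V' then 1 else 0) v)
    (q q' : V → ℝ)
    (hq : IsQRep m E (fun v => (d v : ℝ)) q)
    (hq' : IsQRep m E (fun v => (d' v : ℝ)) q')
    (hU : ∃ v, q' v = 0 ∧ v ∉ V') :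
    ∑ v, q v = (V'.card : ℝ) + ∑ v, q' v := by
  classical
  obtain ⟨hq1, hq2, z, hz⟩ := hq
  obtain ⟨hq1', hq2', -⟩ := hq'
  obtain ⟨u, hu, huV⟩ := hU
  obtain ⟨c, hc⟩ := harm_const m hsym hconn
    (fun v => q v - q' v - (if v ∈ V' then 1 else 0)) (by
      intro v
      have h1 := hq1 v
      have h2 := hq1' v
      have h3 : (d' v : ℝ) = d v + rDivOf m (fun w => if w ∈ V' then 1 else 0) v := by
        rw [hd' v]
        unfold divOf rDivOf
        push_cast
        rfl
      have h4 : rDivOf m (fun v => q v - q' v - (if v ∈ V' then 1 else 0)) v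
          = rDivOf m q v - rDivOf m q' v - rDivOf m (fun w => if w ∈ V' then 1 else 0) v := by
        unfold rDivOf
        rw [← Finset.sum_sub_distrib, ← Finset.sum_sub_distrib]
        exact Finset.sum_congr rfl fun w _ => by ring
      simp only at h1 h2
      linarith)
  have hcu := hc u
  have hcz := hc z
  simp only [huV, if_false] at hcu
  have c1 : 0 ≤ c := by linarith [hq2 u]
  have c2 : c ≤ 0 := by
    have := hq2' z
    split_ifs at hcz <;> linarith
  have c0 : c = 0 := le_antisymm c2 c1
  have hqe : ∀ v, q v = (if v ∈ V' then 1 else 0) + q' v := fun v => by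
    have := hc v
    linarith
  rw [Finset.sum_congr rfl fun v _ => hqe v, Finset.sum_add_distrib]
  simp
end

section
/- Let v be a vertex of G and V ⊆ V(G) \ {v} a set of vertices not containing v. Then for every k ∈ ℝ there exists a function f : V(G) → ℝ such that (1) f has value k at every vertex of V, (2) f(v) = 0, and (3) for every vertex u with u ≠ v and u ∉ V, the sum of the outgoing slopes of f at u vanishes, i.e. ∑_{e = uw} (f(w) − f(u)) = 0, the sum running over all edges adjacent to u. -/
open Finset

variable {V : Type*}

theorem aux_max [Fintype V] (m : V → V → ℕ) (hsym : ∀ a b, m a b = m b a)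
    (hconn : (graphOf m).Connected) (v : V) (S : Set V) (f : V → ℝ)
    (h0 : ∀ u, (u = v ∨ u ∈ S) → f u = 0)
    (h1 : ∀ u, ¬ (u = v ∨ u ∈ S) → (∑ w, (m u w : ℝ) * (f w - f u)) = 0) :
    ∀ u, f u ≤ 0 := by
  haveI : Nonempty V := ⟨v⟩
  obtain ⟨x, hx⟩ := Finite.exists_max f
  have key : ∀ a b : V, (graphOf m).Walk a b → b = v → (∀ u, f u ≤ f a) → f a = 0 := by
    intro a b p
    induction p with
    | nil => intro hb _; exact h0 _ (Or.inl hb)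
    | @cons a c b hadj p ih =>
      intro hb hmax
      by_cases ha : a = v ∨ a ∈ S
      · exact h0 _ ha
      have hz := h1 a ha
      rw [Finset.sum_eq_zero_iff_of_nonpos] at hz
      · have hc := hz c (Finset.mem_univ _)
        have hm : 0 < m a c := by
          simp only [graphOf, SimpleGraph.fromRel_adj] at hadj
          rcases hadj.2 with h | h
          · exact h
          · rw [hsym]; exact h
        have hm' : (m a c : ℝ) ≠ 0 := by positivity
        have hfc : f c = f a := by
          rcases mul_eq_zero.mp hc with h | h
          · exact absurd h hm'
          · linarith
        rw [← hfc]
        exact ih hb (fun u => hfc ▸ hmax u)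
      · intro w _
        exact mul_nonpos_of_nonneg_of_nonpos (Nat.cast_nonneg _) (by linarith [hmax w])
  obtain ⟨p⟩ := hconn.preconnected x v
  intro u
  have := key x v p rfl hx
  linarith [hx u]

/-- Lemma `lma: interpolating function`: for a vertex `v ∉ S` and any
`k ∈ ℝ` there is `f : V(G) → ℝ` with value `k` on `S`, value `0` at `v`, and vanishing
sum of outgoing slopes at every vertex `u ≠ v` with `u ∉ S`. -/
theorem stmt8 [Fintype V] (m : V → V → ℕ) (hsym : ∀ a b, m a b = m b a)
    (hconn : (graphOf m).Connected) (v : V) (S : Set V) (hv : v ∉ S) (k : ℝ) :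
    ∃ f : V → ℝ, (∀ u ∈ S, f u = k) ∧ f v = 0 ∧
      ∀ u, u ≠ v → u ∉ S → (∑ w, (m u w : ℝ) * (f w - f u)) = 0 := by
  classical
  let L : (V → ℝ) →ₗ[ℝ] (V → ℝ) :=
    { toFun := fun f u => if u = v ∨ u ∈ S then f u else ∑ w, (m u w : ℝ) * (f w - f u)
      map_add' := by
        intro f g
        ext u
        simp only [Pi.add_apply]
        split_ifs
        · rfl
        · rw [← Finset.sum_add_distrib]
          exact Finset.sum_congr rfl fun w _ => by ring
      map_smul' := by
        intro c f
        ext u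
        simp only [Pi.smul_apply, smul_eq_mul, RingHom.id_apply]
        split_ifs
        · rfl
        · rw [Finset.mul_sum]
          exact Finset.sum_congr rfl fun w _ => by ring }
  have hL : ∀ f u, L f u = if u = v ∨ u ∈ S then f u else ∑ w, (m u w : ℝ) * (f w - f u) :=
    fun _ _ => rfl
  have hneg : ∀ f, L f = 0 → ∀ u, f u ≤ 0 := by
    intro f hf
    refine aux_max m hsym hconn v S f ?_ ?_
    · intro u hu
      have := congrFun hf u
      rw [hL, if_pos hu] at this
      exact this
    · intro u hu
      have := congrFun hf u
      rw [hL, if_neg hu] at this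
      exact this
  have hinj : Function.Injective L := by
    rw [injective_iff_map_eq_zero]
    intro f hf
    ext u
    have h1 := hneg f hf u
    have h2 := hneg (-f) (by rw [map_neg, hf, neg_zero]) u
    simp only [Pi.neg_apply, Pi.zero_apply] at *
    linarith
  obtain ⟨f, hf⟩ := LinearMap.injective_iff_surjective.mp hinj (fun u => if u ∈ S then k else 0)
  refine ⟨f, ?_, ?_, ?_⟩
  · intro u hu
    have := congrFun hf u
    rw [hL, if_pos (Or.inr hu)] at this
    simpa [hu] using this
  · have := congrFun hf v
    rw [hL, if_pos (Or.inl rfl)] at this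
    simpa [hv] using this
  · intro u hu hS
    have := congrFun hf u
    rw [hL, if_neg (by tauto)] at this
    simpa [hS] using this
end

section
/- Let v be a vertex of G, V ⊆ V(G) \ {v}, k ∈ ℝ, and let f : V(G) → ℝ be any function such that f has value k at every vertex of V, f(v) = 0, and ∑_{e = uw} (f(w) − f(u)) = 0 for every vertex u with u ≠ v and u ∉ V. Then for every vertex u ∈ V such that no simple path from v to u avoids all other vertices of V, one also has ∑_{e = uw} (f(w) − f(u)) = 0. -/
open Finset

variable {V : Type*}

theorem harm_zero [Fintype V] (m : V → V → ℕ) (hsym : ∀ a b, m a b = m b a)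
    (hconn : (graphOf m).Connected) (g : V → ℝ)
    (h : ∀ a, g a * ∑ b, (m a b : ℝ) * (g b - g a) = 0) (v : V) (hv : g v = 0) (a : V) :
    g a = 0 := by
  have h1 : ∑ a, ∑ b, (m a b : ℝ) * (g a * (g b - g a)) = 0 := by
    apply Finset.sum_eq_zero
    intro a _
    rw [← h a, Finset.mul_sum]
    exact Finset.sum_congr rfl fun b _ => by ring
  have h2 : ∑ a, ∑ b, (m a b : ℝ) * (g b * (g a - g b)) = 0 := by
    rw [Finset.sum_comm, ← h1]
    exact Finset.sum_congr rfl fun a _ => Finset.sum_congr rfl fun b _ => by rw [hsym]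
  have h3 : ∑ a, ∑ b, (m a b : ℝ) * (g a - g b) ^ 2 = 0 := by
    have : ∑ a, ∑ b, (m a b : ℝ) * (g a - g b) ^ 2 =
        -(∑ a, ∑ b, (m a b : ℝ) * (g a * (g b - g a))
          + ∑ a, ∑ b, (m a b : ℝ) * (g b * (g a - g b))) := by
      simp only [← Finset.sum_add_distrib, ← Finset.sum_neg_distrib]
      exact Finset.sum_congr rfl fun a _ => Finset.sum_congr rfl fun b _ => by ring
    rw [this, h1, h2]; simp
  have h4 : ∀ a b, (m a b : ℝ) * (g a - g b) ^ 2 = 0 := by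
    intro a b
    have h5 := (Finset.sum_eq_zero_iff_of_nonneg
      (fun a _ => Finset.sum_nonneg fun b _ => by positivity)).1 h3 a (Finset.mem_univ a)
    exact (Finset.sum_eq_zero_iff_of_nonneg (fun b _ => by positivity)).1 h5 b (Finset.mem_univ b)
  have h6 : ∀ a b, (graphOf m).Adj a b → g a = g b := by
    intro a b hab
    have hpos : 0 < m a b := by
      rcases ((SimpleGraph.fromRel_adj _ _ _).1 hab).2 with h | h
      · exact h
      · rw [hsym]; exact h
    have hp : (m a b : ℝ) ≠ 0 := by exact_mod_cast hpos.ne'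
    have := (mul_eq_zero.1 (h4 a b)).resolve_left hp
    have := pow_eq_zero_iff (two_ne_zero) |>.1 this
    linarith
  obtain ⟨p⟩ := hconn.preconnected v a
  have key : ∀ x y, (graphOf m).Walk x y → g x = g y := by
    intro x y p
    induction p with
    | nil => rfl
    | cons hadj _ ih => exact (h6 _ _ hadj).trans ih
  rw [← key v a p, hv]

/-- Remark `rmk:slopes`: if `f` has value `k` on `S`, `f v = 0` and the
outgoing slopes sum to `0` at every `u ≠ v` outside `S`, then the outgoing slopes also
sum to `0` at every `u ∈ S` such that no simple path from `v` to `u` avoids all other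
vertices of `S`. -/
theorem stmt9 [Fintype V] (m : V → V → ℕ) (hsym : ∀ a b, m a b = m b a)
    (hconn : (graphOf m).Connected) (v : V) (S : Set V) (hv : v ∉ S) (k : ℝ)
    (f : V → ℝ) (hfS : ∀ u ∈ S, f u = k) (hfv : f v = 0)
    (hslope : ∀ u, u ≠ v → u ∉ S → (∑ w, (m u w : ℝ) * (f w - f u)) = 0)
    (u : V) (hu : u ∈ S)
    (hnopath : ¬ ∃ p : (graphOf m).Walk v u, p.IsPath ∧ ∀ w ∈ p.support, w ∈ S → w = u) :
    (∑ w, (m u w : ℝ) * (f w - f u)) = 0 := by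
  classical
  let R : Set V := {w | ∃ p : (graphOf m).Walk v w, ∀ x ∈ p.support, x ∉ S}
  have hvR : v ∈ R := ⟨SimpleGraph.Walk.nil, by simpa using hv⟩
  have hRS : ∀ a ∈ R, a ∉ S := fun a ⟨p, hp⟩ => hp a p.end_mem_support
  have hadj : ∀ a b, a ≠ b → m a b ≠ 0 → (graphOf m).Adj a b := by
    intro a b hab hm
    exact (SimpleGraph.fromRel_adj _ _ _).2 ⟨hab, Or.inl (Nat.pos_of_ne_zero hm)⟩
  have hstep : ∀ a b, a ∈ R → m a b ≠ 0 → b ∉ S → b ∈ R := by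
    intro a b ha hm hb
    by_cases hab : a = b
    · exact hab ▸ ha
    obtain ⟨p, hp⟩ := ha
    refine ⟨p.concat (hadj a b hab hm), ?_⟩
    intro x hx
    rw [SimpleGraph.Walk.support_concat] at hx
    simp only [List.mem_append, List.mem_singleton] at hx
    rcases hx with hx | rfl
    · exact hp x hx
    · exact hb
  have huR : ∀ a, m u a ≠ 0 → a ∉ R := by
    intro a hm ha
    have hau : a ≠ u := fun h => hRS a ha (h ▸ hu)
    obtain ⟨p, hp⟩ := ha
    apply hnopath
    refine ⟨(p.concat (hadj a u hau (by rwa [hsym]))).bypass,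
      SimpleGraph.Walk.bypass_isPath _, ?_⟩
    intro x hx hxS
    have hx := SimpleGraph.Walk.support_bypass_subset _ hx
    rw [SimpleGraph.Walk.support_concat] at hx
    simp only [List.mem_append, List.mem_singleton] at hx
    rcases hx with hx | rfl
    · exact absurd hxS (hp x hx)
    · rfl
  let g : V → ℝ := fun a => if a ∈ R then 0 else f a - k
  have hg : ∀ a, g a = 0 := by
    apply harm_zero m hsym hconn g _ v (if_pos hvR)
    intro a
    by_cases haR : a ∈ R
    · simp [g, haR]
    by_cases haS : a ∈ S
    · simp [g, haR, hfS a haS]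
    have hav : a ≠ v := fun h => haR (h ▸ hvR)
    rw [← mul_zero (g a), ← hslope a hav haS]
    congr 1
    refine Finset.sum_congr rfl fun b _ => ?_
    by_cases hm : m a b = 0
    · simp [hm]
    have hbR : b ∉ R := fun hb => haR (hstep b a hb (by rwa [hsym]) haS)
    simp [g, haR, hbR]
  refine Finset.sum_eq_zero fun b _ => ?_
  by_cases hm : m u b = 0
  · simp [hm]
  have h1 : g b = f b - k := if_neg (huR b hm)
  have h2 := hg b
  rw [hfS u hu, ← h1, h2, mul_zero]
end

section
/- Let V ⊆ V(G) be nonempty, let D be an ℝ-divisor of degree d that is effective away from V, and let E be an ℝ-divisor of degree d supported on V. Then U_0(q_E(D)) ∩ V is nonempty. -/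
open Finset

variable {V : Type*}

/-- Lemma `lma:zero set` (1): for `D` effective away from `S` and `E`
supported on `S` of the same degree, `U₀(q_E(D)) ∩ S ≠ ∅`. -/
theorem stmt10 [Fintype V] (m : V → V → ℕ) (hsym : ∀ a b, m a b = m b a)
    (hconn : (graphOf m).Connected) (S : Set V) (hS : S.Nonempty)
    (D E : V → ℝ) (hdeg : ∑ v, D v = ∑ v, E v)
    (hD : ∀ v ∉ S, 0 ≤ D v) (hE : ∀ v, E v ≠ 0 → v ∈ S)
    (q : V → ℝ) (hq : IsQRep m E D q) :
    ∃ v ∈ S, q v = 0 := by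
  obtain ⟨h1, h2, v0, hv0⟩ := hq
  by_contra hcon
  push Not at hcon
  have step : ∀ a b, (graphOf m).Adj a b → q a = 0 → q b = 0 := by
    intro a b hab ha
    have haS : a ∉ S := fun h => hcon a h ha
    have hEa : E a = 0 := by
      by_contra h
      exact haS (hE a h)
    have hm : 0 < m a b := by
      rw [graphOf, SimpleGraph.fromRel_adj] at hab
      rcases hab.2 with h | h
      · exact h
      · rw [hsym]; exact h
    have hle : (m a b : ℝ) * (q b - q a) ≤ rDivOf m q a := by
      unfold rDivOf
      refine Finset.single_le_sum (f := fun w => (m a w : ℝ) * (q w - q a)) ?_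
        (Finset.mem_univ b)
      intro w _
      have := h2 w
      rw [ha, sub_zero]
      positivity
    have h3 := h1 a
    have h4 := hD a haS
    have hm' : (0 : ℝ) < m a b := by exact_mod_cast hm
    rw [ha, sub_zero] at hle
    have h5 := h2 b
    by_contra hb
    have h6 : 0 < q b := lt_of_le_of_ne h5 (Ne.symm hb)
    have := mul_pos hm' h6
    linarith
  have walk : ∀ a b, (graphOf m).Walk a b → q a = 0 → q b = 0 := by
    intro a b p
    induction p with
    | nil => exact id
    | cons h p ih => exact fun ha => ih (step _ _ h ha)
  obtain ⟨s, hs⟩ := hS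
  obtain ⟨p⟩ := hconn.preconnected v0 s
  exact hcon s hs (walk _ _ p hv0)
end

section
/- Let V ⊆ V(G) be nonempty, let D be an ℝ-divisor of degree d effective away from V, and let E be an ℝ-divisor of degree d supported on V. If v ∈ U_0(q_E(D)) and v ∉ V, then U_0(q_E(D)) contains the entire connected component of v in the graph G − V (obtained from G by deleting the vertices of V and all edges adjacent to them), as well as every vertex of V adjacent to a vertex of that component. -/
open Finset

variable {V : Type*}

/-- Lemma `lma:zero set` (2): if `v ∈ U₀(q_E(D))` and `v ∉ S`, then
`U₀(q_E(D))` contains the connected component of `v` in `G - S` together with every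
vertex of `S` adjacent to that component. -/
theorem stmt11 [Fintype V] (m : V → V → ℕ) (hsym : ∀ a b, m a b = m b a)
    (hconn : (graphOf m).Connected) (S : Set V) (hS : S.Nonempty)
    (D E : V → ℝ) (hdeg : ∑ v, D v = ∑ v, E v)
    (hD : ∀ v ∉ S, 0 ≤ D v) (hE : ∀ v, E v ≠ 0 → v ∈ S)
    (q : V → ℝ) (hq : IsQRep m E D q)
    (v : V) (hv0 : q v = 0) (hvS : v ∉ S) :
    (∀ w, Relation.ReflTransGen
        (fun a b => a ∉ S ∧ b ∉ S ∧ (graphOf m).Adj a b) v w → q w = 0) ∧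
    (∀ u ∈ S, (∃ w, Relation.ReflTransGen
        (fun a b => a ∉ S ∧ b ∉ S ∧ (graphOf m).Adj a b) v w ∧ (graphOf m).Adj w u) →
      q u = 0) := by
  have key : ∀ a, a ∉ S → q a = 0 → ∀ b, (graphOf m).Adj a b → q b = 0 := by
    intro a haS ha b hab
    have hm : 0 < m a b := by
      unfold graphOf at hab
      rw [SimpleGraph.fromRel_adj] at hab
      rcases hab.2 with h | h
      · exact h
      · rw [hsym]; exact h
    have hEa : E a = 0 := by
      by_contra h
      exact haS (hE a h)
    have h1 := hq.1 a
    have h2 := hD a haS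
    have hnn : ∀ w ∈ (Finset.univ : Finset V), 0 ≤ (m a w : ℝ) * (q w - q a) := by
      intro w _
      rw [ha, sub_zero]
      exact mul_nonneg (Nat.cast_nonneg _) (hq.2.1 w)
    have h3 : ∑ w, (m a w : ℝ) * (q w - q a) = 0 := by
      have h4 := Finset.sum_nonneg hnn
      unfold rDivOf at h1
      linarith
    have h5 := (Finset.sum_eq_zero_iff_of_nonneg hnn).1 h3 b (Finset.mem_univ b)
    rw [ha, sub_zero] at h5
    rcases mul_eq_zero.1 h5 with h | h
    · have : m a b = 0 := by exact_mod_cast h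
      omega
    · exact h
  have key2 : ∀ w, Relation.ReflTransGen
      (fun a b => a ∉ S ∧ b ∉ S ∧ (graphOf m).Adj a b) v w → q w = 0 ∧ w ∉ S := by
    intro w hw
    induction hw with
    | refl => exact ⟨hv0, hvS⟩
    | tail _ h ih => exact ⟨key _ h.1 ih.1 _ h.2.2, h.2.1⟩
  refine ⟨fun w hw => (key2 w hw).1, ?_⟩
  rintro u _ ⟨w, hw, hadj⟩
  exact key w (key2 w hw).2 (key2 w hw).1 u hadj
end

section
/- Let V ⊆ V(G) be nonempty and let D be an ℝ-divisor of degree d that is effective away from V. Then there exists an ℝ-divisor E of degree d, supported on V, such that q_E(D) has value 0 at every vertex of V. -/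
open Finset

variable {V : Type*}

theorem min_principle_aux [Fintype V] (m : V → V → ℕ) (hsym : ∀ a b, m a b = m b a)
    (hconn : (graphOf m).Connected) (S : Set V) (hS : S.Nonempty)
    (f : V → ℝ) (h0 : ∀ v ∈ S, f v = 0) (h1 : ∀ v ∉ S, rDivOf m f v ≤ 0) (v : V) :
    0 ≤ f v := by
  obtain ⟨s, hs⟩ := hS
  have : Nonempty V := ⟨s⟩
  obtain ⟨u, hu⟩ := Finite.exists_min f
  by_contra hneg
  push Not at hneg
  have hun : f u < 0 := lt_of_le_of_lt (hu v) hneg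
  have step : ∀ a b, (graphOf m).Adj a b → f a = f u → f b = f u := by
    intro a b hab ha
    have haS : a ∉ S := fun h => by have := h0 a h; linarith
    have hm : 0 < m a b := by
      have h := hab
      simp only [graphOf, SimpleGraph.fromRel_adj] at h
      rcases h.2 with h | h
      · exact h
      · rw [hsym]; exact h
    have hnn : ∀ w ∈ (Finset.univ : Finset V), 0 ≤ (m a w : ℝ) * (f w - f a) := by
      intro w _
      have := hu w
      exact mul_nonneg (Nat.cast_nonneg _) (by linarith)
    have hle := h1 a haS
    have hz := (Finset.sum_eq_zero_iff_of_nonneg hnn).1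
      (le_antisymm hle (Finset.sum_nonneg hnn)) b (Finset.mem_univ b)
    have hm' : (m a b : ℝ) ≠ 0 := by exact_mod_cast hm.ne'
    have := (mul_eq_zero.1 hz).resolve_left hm'
    linarith
  have walk : ∀ a b, (graphOf m).Walk a b → f a = f u → f b = f u := by
    intro a b p
    induction p with
    | nil => exact id
    | cons h _ ih => exact fun ha => ih (step _ _ h ha)
  obtain ⟨p⟩ := hconn.preconnected u s
  have := walk u s p rfl
  have := h0 s hs
  linarith

open Classical in
/-- The Dirichlet operator: identity on `S`, Laplacian off `S`. -/
noncomputable def dirichletOp [Fintype V] (m : V → V → ℕ) (S : Set V) :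
    (V → ℝ) →ₗ[ℝ] (V → ℝ) where
  toFun f v := if v ∈ S then f v else rDivOf m f v
  map_add' f g := by
    funext v
    by_cases h : v ∈ S
    · simp [h]
    · simp only [h, if_false, Pi.add_apply, rDivOf, ← Finset.sum_add_distrib]
      exact Finset.sum_congr rfl fun w _ => by ring
  map_smul' c f := by
    funext v
    by_cases h : v ∈ S
    · simp [h]
    · simp only [h, if_false, Pi.smul_apply, smul_eq_mul, rDivOf, Finset.mul_sum, RingHom.id_apply]
      exact Finset.sum_congr rfl fun w _ => by ring

theorem sum_rDivOf_aux [Fintype V] (m : V → V → ℕ) (hsym : ∀ a b, m a b = m b a)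
    (f : V → ℝ) : ∑ v, rDivOf m f v = 0 := by
  have h : ∑ v, rDivOf m f v = - ∑ v, rDivOf m f v := by
    conv_lhs => simp only [rDivOf]
    rw [Finset.sum_comm, ← Finset.sum_neg_distrib]
    refine Finset.sum_congr rfl fun a _ => ?_
    rw [rDivOf, ← Finset.sum_neg_distrib]
    refine Finset.sum_congr rfl fun b _ => ?_
    rw [hsym b a]; ring
  linarith

/-- Lemma `lma:R divisor`: for `D` effective away from a nonempty `S`,
there is an ℝ-divisor `E` of the same degree, supported on `S`, with `q_E(D)` vanishing
on all of `S`. -/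
theorem stmt12 [Fintype V] (m : V → V → ℕ) (hsym : ∀ a b, m a b = m b a)
    (hconn : (graphOf m).Connected) (S : Set V) (hS : S.Nonempty)
    (D : V → ℝ) (hD : ∀ v ∉ S, 0 ≤ D v) :
    ∃ E : V → ℝ, ∃ q : V → ℝ,
      (∑ v, E v = ∑ v, D v) ∧ (∀ v, E v ≠ 0 → v ∈ S) ∧
      IsQRep m E D q ∧ ∀ v ∈ S, q v = 0 := by
  classical
  have hinj : Function.Injective (dirichletOp m S) := by
    rw [injective_iff_map_eq_zero]
    intro f hf
    have key : ∀ g : V → ℝ, dirichletOp m S g = 0 → ∀ v, 0 ≤ g v := by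
      intro g hg
      refine min_principle_aux m hsym hconn S hS g ?_ ?_
      · intro v hv
        have := congrFun hg v
        simpa [dirichletOp, hv] using this
      · intro v hv
        have := congrFun hg v
        simp [dirichletOp, hv] at this
        exact this.le
    have h2 := key (-f) (by rw [map_neg, hf, neg_zero])
    funext v
    have a := key f hf v
    have b := h2 v
    simp only [Pi.neg_apply] at b
    simp only [Pi.zero_apply]
    linarith
  obtain ⟨q, hq⟩ := (LinearMap.injective_iff_surjective.1 hinj)
    (fun v => if v ∈ S then 0 else - D v)
  have hq0 : ∀ v ∈ S, q v = 0 := by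
    intro v hv
    have := congrFun hq v
    simpa [dirichletOp, hv] using this
  have hq1 : ∀ v ∉ S, rDivOf m q v = - D v := by
    intro v hv
    have := congrFun hq v
    simpa [dirichletOp, hv] using this
  refine ⟨fun v => D v + rDivOf m q v, q, ?_, ?_, ⟨fun v => rfl, ?_, ?_⟩, hq0⟩
  · rw [Finset.sum_add_distrib, sum_rDivOf_aux m hsym, add_zero]
  · intro v hv
    by_contra h
    exact hv (by simp [hq1 v h])
  · refine min_principle_aux m hsym hconn S hS q hq0 ?_
    intro v hv
    rw [hq1 v hv]
    linarith [hD v hv]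
  · obtain ⟨s, hs⟩ := hS
    exact ⟨s, hq0 s hs⟩
end

section
/- Let δ be a special divisor class on G. Then δ contains a representative d such that for every vertex v ∈ V(G): −1 ≤ d_v ≤ 2g_v − 2 + val(v), and moreover d_v = −1 is only possible if g_v = 0 and no loop is adjacent to v. -/
open Finset

variable {V : Type*}

theorem divOf_add_aux [Fintype V] (m : V → V → ℕ) (f h : V → ℤ) (v : V) :
    divOf m (fun w => f w + h w) v = divOf m f v + divOf m h v := by
  unfold divOf
  rw [← Finset.sum_add_distrib]
  exact Finset.sum_congr rfl fun w _ => by ring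

theorem fire_aux [Fintype V] (m : V → V → ℕ) (k : V → ℤ) (n : ℕ) :
    ∀ (D f : V → ℤ), (∀ v, 0 ≤ D v) → (∀ v, 0 ≤ f v) → (∑ v, f v) = (n : ℤ) →
      (∀ v, D v + divOf m f v ≤ k v) →
      ∃ h : V → ℤ, ∀ v, 0 ≤ D v + divOf m h v ∧
        (D v + divOf m h v ≤ k v ∨
          D v + divOf m h v < (∑ w, (m v w : ℤ)) - (m v v : ℤ)) := by
  classical
  induction n with
  | zero =>
    intro D f hD hf hs hk
    have h0 : ∀ v, f v = 0 := by
      intro v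
      exact (Finset.sum_eq_zero_iff_of_nonneg (fun v _ => hf v)).1 (by simpa using hs) v
        (Finset.mem_univ v)
    have hd : ∀ v, divOf m f v = 0 := by
      intro v; simp [divOf, h0]
    refine ⟨f, fun v => ⟨?_, Or.inl (hk v)⟩⟩
    rw [hd]; simpa using hD v
  | succ n ih =>
    intro D f hD hf hs hk
    by_cases hb : ∃ v, k v < D v ∧ (∑ w, (m v w : ℤ)) - (m v v : ℤ) ≤ D v
    · obtain ⟨v, hv1, hv2⟩ := hb
      have hneg : divOf m f v < 0 := by linarith [hk v]
      have hfv : 1 ≤ f v := by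
        by_contra hc
        have h0 : f v = 0 := le_antisymm (by omega) (hf v)
        have : 0 ≤ divOf m f v := by
          unfold divOf
          refine Finset.sum_nonneg fun w _ => ?_
          rw [h0, sub_zero]
          exact mul_nonneg (by positivity) (hf w)
        omega
      let p : V → ℤ := Pi.single v 1
      have hadd : ∀ q : V → ℤ, ∀ u, divOf m (fun w => p w + q w) u
        = divOf m p u + divOf m q u := fun q u => divOf_add_aux m p q u
      have hpv : divOf m p v = -((∑ w, (m v w : ℤ)) - (m v v : ℤ)) := by
        simp [divOf, p, mul_sub, Finset.sum_sub_distrib, Pi.single_apply]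
      have hpu : ∀ u, u ≠ v → 0 ≤ divOf m p u := by
        intro u hu
        simp [divOf, p, hu, Pi.single_apply]
      have hf' : f = fun w => p w + (f w - p w) := by
        funext w; ring
      have key := ih (fun u => D u + divOf m p u) (fun w => f w - p w)
      refine Exists.elim (key ?_ ?_ ?_ ?_) ?_
      rotate_left 4
      · intro h hh
        refine ⟨fun w => p w + h w, fun u => ?_⟩
        rw [hadd, ← add_assoc]
        exact hh u
      · intro u
        by_cases hu : u = v
        · subst hu
          simp only [hpv]; linarith
        · exact add_nonneg (hD u) (hpu u hu)
      · intro u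
        by_cases hu : u = v
        · subst hu
          simp [p]; linarith
        · simp [p, hu, hf u]
      · rw [Finset.sum_sub_distrib, hs]
        simp [p]
      · intro u
        have := hk u
        rw [hf', hadd] at this
        linarith
    · push Not at hb
      refine ⟨fun _ => 0, fun v => ?_⟩
      have hd : divOf m (fun _ => (0 : ℤ)) v = 0 := by simp [divOf]
      rw [hd, add_zero]
      refine ⟨hD v, ?_⟩
      by_cases h : D v ≤ k v
      · exact Or.inl h
      · exact Or.inr (hb v (not_le.1 h))

/-- Theorem B: every special divisor class contains a representative `d`
with `-1 ≤ d v ≤ 2 g v - 2 + val v` for all `v`, and `d v = -1` only possible when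
`g v = 0` and no loop is adjacent to `v`. -/
theorem stmt15 [Fintype V] (m : V → V → ℕ) (hsym : ∀ a b, m a b = m b a)
    (hconn : (graphOf m).Connected) (g : V → ℕ) (d₀ : V → ℤ)
    (hspecial : Special m g d₀) :
    ∃ d : V → ℤ, LinEquiv m d₀ d ∧
      ∀ v, (-1 ≤ d v ∧ d v ≤ 2 * (g v : ℤ) - 2 + (valence m v : ℤ)) ∧
        (d v = -1 → g v = 0 ∧ m v v = 0) := by
  classical
  obtain ⟨⟨e₁, ⟨f₁, h₁⟩, he₁⟩, ⟨e₂, ⟨f₂, h₂⟩, he₂⟩⟩ := hspecial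
  let f : V → ℤ := fun w => f₁ w + f₂ w
  let c : ℤ := ∑ v, |f v|
  have hc : ∀ v, 0 ≤ f v + c := by
    intro v
    have h1 : |f v| ≤ c :=
      Finset.single_le_sum (f := fun v => |f v|) (fun w _ => abs_nonneg _) (Finset.mem_univ v)
    linarith [neg_abs_le (f v)]
  have hconst : ∀ v, divOf m (fun _ => c) v = 0 := by intro v; simp [divOf]
  obtain ⟨h, hh⟩ := fire_aux m (canon m g) (∑ v, (f v + c)).toNat e₂ (fun v => f v + c) he₂ hc
    (Int.toNat_of_nonneg (Finset.sum_nonneg fun v _ => hc v)).symm (by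
      intro v
      rw [divOf_add_aux, hconst, divOf_add_aux, ← h₁, ← h₂]
      linarith [he₁ v])
  refine ⟨fun v => canon m g v - (e₂ v + divOf m h v), ⟨fun w => h w + (-f₂ w), ?_⟩, ?_⟩
  · intro v
    have hn : divOf m (fun w => -f₂ w) v = - divOf m f₂ v := by
      unfold divOf
      rw [← Finset.sum_neg_distrib]
      exact Finset.sum_congr rfl fun w _ => by ring
    rw [divOf_add_aux, hn, ← h₂]
    ring
  · intro v
    obtain ⟨ha, hb⟩ := hh v
    have hk : canon m g v = 2 * (g v : ℤ) - 2 + (valence m v : ℤ) := rfl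
    have hval : (valence m v : ℤ) = (∑ w, (m v w : ℤ)) + m v v := by
      simp [valence]
    simp only
    refine ⟨⟨?_, ?_⟩, ?_⟩ <;> omega
end

section
/- Suppose every vertex v of G with weight g_v = 0 is adjacent to a loop. Then every special divisor class on G contains a uniform representative. -/
open Finset

variable {V : Type*}

lemma aux_divOf_add [Fintype V] (m : V → V → ℕ) (f h : V → ℤ) (v : V) :
    divOf m (fun x => f x + h x) v = divOf m f v + divOf m h v := by
  unfold divOf
  rw [← Finset.sum_add_distrib]
  exact Finset.sum_congr rfl fun w _ => by ring

lemma aux_main [Fintype V] (m : V → V → ℕ) (g : V → ℕ)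
    (hloops : ∀ v, g v = 0 → 0 < m v v) :
    ∀ (n : ℕ) (f : V → ℤ) (d : V → ℤ), (∀ v, 0 ≤ f v) → (∑ v, f v = n) → (∀ v, 0 ≤ d v) →
      (∀ v, d v + divOf m f v ≤ canon m g v) →
      ∃ h : V → ℤ, Uniform m g (fun v => d v + divOf m h v) := by
  classical
  intro n
  induction n with
  | zero =>
    intro f d hf hs hd hk
    have h0 : ∀ v, f v = 0 := by
      intro v
      have := (Finset.sum_eq_zero_iff_of_nonneg (fun v _ => hf v)).1 (by simpa using hs)
      exact this v (Finset.mem_univ v)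
    refine ⟨f, fun v => ⟨?_, hk v⟩⟩
    have : divOf m f v = 0 := by simp [divOf, h0]
    simp only [this]; simpa using hd v
  | succ n ih =>
    intro f d hf hs hd hk
    by_cases hex : ∃ v, 0 < f v ∧ canon m g v < d v
    · obtain ⟨v, hv, hdv⟩ := hex
      let p : V → ℤ := fun x => if x = v then 1 else 0
      have hfp : ∀ x, divOf m (fun x => f x - p x) x = divOf m f x - divOf m p x := by
        intro x
        have := aux_divOf_add m (fun x => f x - p x) p x
        simp only [sub_add_cancel] at this
        linarith
      have hpv : divOf m p v = m v v - ∑ w, (m v w : ℤ) := by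
        have : ∀ w, (m v w : ℤ) * (p w - p v) = (if w = v then (m v w : ℤ) else 0) - m v w := by
          intro w
          by_cases h : w = v <;> simp [p, h]
        unfold divOf
        simp only [this, Finset.sum_sub_distrib]
        simp
      have hd1 : ∀ x, 0 ≤ d x + divOf m p x := by
        intro x
        by_cases hx : x = v
        · subst hx
          rw [hpv]
          have hc : canon m g x = 2 * (g x : ℤ) - 2 + ((∑ w, (m x w : ℤ)) + m x x) := by
            simp [canon, valence]
          have := hloops x
          have : 0 ≤ (g x : ℤ) - 1 + m x x := by omega
          linarith [hd x]
        · have : 0 ≤ divOf m p x := by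
            unfold divOf
            refine Finset.sum_nonneg fun w _ => ?_
            simp only [p, hx, if_false, sub_zero]
            split_ifs <;> simp
          linarith [hd x]
      obtain ⟨h, hh⟩ := ih (fun x => f x - p x) (fun x => d x + divOf m p x)
        (by
          intro x
          by_cases hx : x = v
          · subst hx; simp [p]; omega
          · simpa [p, hx] using hf x)
        (by
          rw [Finset.sum_sub_distrib, hs]
          simp [p])
        hd1
        (by
          intro x
          rw [hfp]
          linarith [hk x])
      refine ⟨fun x => p x + h x, fun x => ?_⟩
      have := hh x
      simp only [aux_divOf_add]
      simpa only [add_assoc] using this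
    · push Not at hex
      refine ⟨fun _ => 0, fun v => ?_⟩
      have hz : divOf m (fun _ => 0) v = 0 := by simp [divOf]
      simp only [hz, add_zero]
      refine ⟨hd v, ?_⟩
      by_cases hv : 0 < f v
      · exact hex v hv
      · have h0 : f v = 0 := le_antisymm (not_lt.1 hv) (hf v)
        have : 0 ≤ divOf m f v := by
          unfold divOf
          refine Finset.sum_nonneg fun w _ => ?_
          rw [h0, sub_zero]
          exact mul_nonneg (by positivity) (hf w)
        linarith [hk v]

/-- if every weight-zero vertex of `G` is adjacent to a loop, then every
special divisor class contains a uniform representative. -/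
theorem stmt16 [Fintype V] (m : V → V → ℕ) (hsym : ∀ a b, m a b = m b a)
    (hconn : (graphOf m).Connected) (g : V → ℕ)
    (hloops : ∀ v, g v = 0 → 0 < m v v)
    (d₀ : V → ℤ) (hspecial : Special m g d₀) :
    ∃ d : V → ℤ, LinEquiv m d₀ d ∧ Uniform m g d := by
  obtain ⟨⟨e, ⟨f1, h1⟩, he⟩, ⟨e', ⟨f2, h2⟩, he'⟩⟩ := hspecial
  let C : ℤ := ∑ v, |f1 v + f2 v|
  let f : V → ℤ := fun v => (f1 v + f2 v) + C
  have hf : ∀ v, 0 ≤ f v := by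
    intro v
    have : |f1 v + f2 v| ≤ C :=
      Finset.single_le_sum (f := fun v => |f1 v + f2 v|) (fun _ _ => abs_nonneg _)
        (Finset.mem_univ v)
    have := neg_abs_le (f1 v + f2 v)
    simp only [f]
    linarith
  have hdiv : ∀ v, divOf m f v = divOf m f1 v + divOf m f2 v := by
    intro v
    rw [← aux_divOf_add]
    simp [divOf, f]
  obtain ⟨h, hh⟩ := aux_main m g hloops (∑ v, f v).toNat f e hf
    (Int.toNat_of_nonneg (Finset.sum_nonneg fun v _ => hf v)).symm he (by
      intro v
      rw [hdiv]
      have := h1 v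
      have := h2 v
      have := he' v
      linarith)
  refine ⟨_, ⟨fun v => f1 v - h v, fun v => ?_⟩, hh⟩
  have := aux_divOf_add m (fun v => f1 v - h v) h v
  simp only [sub_add_cancel] at this
  have := h1 v
  linarith
end
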